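/- The following operator identity holds on ℓ²(ℕ×ℕ): A₁*A₁A₂*A₂ − q² B₁²B₂² + A₁*A₁B₂² − B₁²A₂A₂* + q² B₁²A₂*A₂ − q² A₁A₁*B₂² + q² B₁²B₂² − A₁A₁*A₂A₂* = 2(1 − q²) B₂². (This is the cosphere-bundle symbol computation ρ(Σ_{k,l} U*_{kl} δ(U_{lk}))⁰ = 2(1 − q²)·1 ⊗ r₋(b)², the key step in evaluating the local cyclic cocycle ψ₁ on the unitary U generating K₁(A(SU_q(2))) and obtaining ind(PUP) = 1.) -/

import Mathlib

namespace HilbertBasis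

variable {ι H : Type*} [NormedAddCommGroup H] [InnerProductSpace ℂ H]

theorem continuousLinearMap_ext (e : HilbertBasis ι ℂ H) {S T : H →L[ℂ] H}
    (h : ∀ i, S (e i) = T (e i)) : S = T := by
  refine ContinuousLinearMap.ext_on
    (Submodule.dense_iff_topologicalClosure_eq_top.mpr e.dense_span) ?_
  rintro _ ⟨i, rfl⟩
  exact h i

theorem eq_of_forall_inner_eq (e : HilbertBasis ι ℂ H) {u v : H}
    (h : ∀ i, inner ℂ (e i) u = inner ℂ (e i) v) : u = v := by
  refine e.repr.injective (lp.ext (funext fun i => ?_))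
  rw [e.repr_apply_apply, e.repr_apply_apply, h]

variable [CompleteSpace H] (e : HilbertBasis ι ℂ H) {A : H →L[ℂ] H} {s : ι → ι} {c : ι → ℝ}

theorem adjoint_weightedShift_apply (hs : Function.Injective s)
    (hA : ∀ i, A (e i) = (c i : ℂ) • e (s i)) (i : ι) :
    ContinuousLinearMap.adjoint A (e (s i)) = (c i : ℂ) • e i := by
  classical
  refine e.eq_of_forall_inner_eq fun k => ?_
  rw [ContinuousLinearMap.adjoint_inner_right, hA, inner_smul_left, inner_smul_right,
    orthonormal_iff_ite.mp e.orthonormal, orthonormal_iff_ite.mp e.orthonormal]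
  by_cases hk : k = i
  · simp [hk]
  · simp [hk, hs.ne hk]

theorem adjoint_weightedShift_apply_of_notMem_range
    (hA : ∀ i, A (e i) = (c i : ℂ) • e (s i)) {j : ι} (hj : j ∉ Set.range s) :
    ContinuousLinearMap.adjoint A (e j) = 0 := by
  refine e.eq_of_forall_inner_eq fun k => ?_
  rw [ContinuousLinearMap.adjoint_inner_right, hA, inner_smul_left,
    e.orthonormal.inner_eq_zero fun h => hj ⟨k, h⟩, mul_zero, inner_zero_right]

end HilbertBasis

theorem ofReal_sqrt_one_sub_pow_mul_self {q : ℝ} (hq0 : 0 < q) (hq1 : q < 1) (n : ℕ) :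
    ((Real.sqrt (1 - q ^ n) : ℝ) : ℂ) * ((Real.sqrt (1 - q ^ n) : ℝ) : ℂ) =
      1 - (q : ℂ) ^ n := by
  rw [← Complex.ofReal_mul, Real.mul_self_sqrt (sub_nonneg.mpr (pow_le_one₀ hq0.le hq1.le))]
  push_cast
  rfl

/-- **The cosphere-bundle symbol computation `ρ(Σ_{k,l} U*_{kl} δ(U_{lk}))⁰ = 2(1-q²)·1 ⊗ r₋(b)²`.**

Fix `0 < q < 1`.  On `ℓ²(ℕ×ℕ)` with standard orthonormal (Hilbert) basis `(e (x,y))`, let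
`A₁ e_{x,y} = √(1-q^(2x+2)) e_{x+1,y}`, `B₁ e_{x,y} = q^x e_{x,y}` (the quantum disk
representation `π₊` on the first index) and `A₂ e_{x,y} = √(1-q^(2y+2)) e_{x,y+1}`,
`B₂ e_{x,y} = -q^y e_{x,y}` (the representation `π₋` on the second index).  Then
`A₁*A₁A₂*A₂ - q²B₁²B₂² + A₁*A₁B₂² - B₁²A₂A₂* + q²B₁²A₂*A₂ - q²A₁A₁*B₂² + q²B₁²B₂²
 - A₁A₁*A₂A₂* = 2(1-q²) B₂²`. -/
theorem cosphere_symbol_identity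
    {H : Type*} [NormedAddCommGroup H] [InnerProductSpace ℂ H] [CompleteSpace H]
    (e : HilbertBasis (ℕ × ℕ) ℂ H)
    (q : ℝ) (hq0 : 0 < q) (hq1 : q < 1)
    (A₁ B₁ A₂ B₂ : H →L[ℂ] H)
    (hA₁ : ∀ x y : ℕ, A₁ (e (x, y)) = ((Real.sqrt (1 - q ^ (2 * x + 2)) : ℝ) : ℂ) • e (x + 1, y))
    (hB₁ : ∀ x y : ℕ, B₁ (e (x, y)) = ((q ^ x : ℝ) : ℂ) • e (x, y))
    (hA₂ : ∀ x y : ℕ, A₂ (e (x, y)) = ((Real.sqrt (1 - q ^ (2 * y + 2)) : ℝ) : ℂ) • e (x, y + 1))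
    (hB₂ : ∀ x y : ℕ, B₂ (e (x, y)) = ((-(q ^ y) : ℝ) : ℂ) • e (x, y)) :
    ContinuousLinearMap.adjoint A₁ * A₁ * (ContinuousLinearMap.adjoint A₂ * A₂)
      - (q : ℂ) ^ 2 • (B₁ ^ 2 * B₂ ^ 2)
      + ContinuousLinearMap.adjoint A₁ * A₁ * B₂ ^ 2
      - B₁ ^ 2 * (A₂ * ContinuousLinearMap.adjoint A₂)
      + (q : ℂ) ^ 2 • (B₁ ^ 2 * (ContinuousLinearMap.adjoint A₂ * A₂))
      - (q : ℂ) ^ 2 • (A₁ * ContinuousLinearMap.adjoint A₁ * B₂ ^ 2)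
      + (q : ℂ) ^ 2 • (B₁ ^ 2 * B₂ ^ 2)
      - A₁ * ContinuousLinearMap.adjoint A₁ * (A₂ * ContinuousLinearMap.adjoint A₂)
      = (2 * (1 - (q : ℂ) ^ 2)) • B₂ ^ 2 := by
  have hs₁ : Function.Injective fun p : ℕ × ℕ => (p.1 + 1, p.2) := by
    rintro ⟨a, b⟩ ⟨c, d⟩ h
    simpa using h
  have hs₂ : Function.Injective fun p : ℕ × ℕ => (p.1, p.2 + 1) := by
    rintro ⟨a, b⟩ ⟨c, d⟩ h
    simpa using h
  have hA₁' (p : ℕ × ℕ) : A₁ (e p) =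
      ((Real.sqrt (1 - q ^ (2 * p.1 + 2)) : ℝ) : ℂ) • e (p.1 + 1, p.2) := hA₁ p.1 p.2
  have hA₂' (p : ℕ × ℕ) : A₂ (e p) =
      ((Real.sqrt (1 - q ^ (2 * p.2 + 2)) : ℝ) : ℂ) • e (p.1, p.2 + 1) := hA₂ p.1 p.2
  have adj₁ (x y : ℕ) : ContinuousLinearMap.adjoint A₁ (e (x + 1, y)) =
      ((Real.sqrt (1 - q ^ (2 * x + 2)) : ℝ) : ℂ) • e (x, y) :=
    e.adjoint_weightedShift_apply hs₁ hA₁' (x, y)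
  have adj₂ (x y : ℕ) : ContinuousLinearMap.adjoint A₂ (e (x, y + 1)) =
      ((Real.sqrt (1 - q ^ (2 * y + 2)) : ℝ) : ℂ) • e (x, y) :=
    e.adjoint_weightedShift_apply hs₂ hA₂' (x, y)
  have adj₁_zero (y : ℕ) : ContinuousLinearMap.adjoint A₁ (e (0, y)) = 0 :=
    e.adjoint_weightedShift_apply_of_notMem_range hA₁' (by simp)
  have adj₂_zero (x : ℕ) : ContinuousLinearMap.adjoint A₂ (e (x, 0)) = 0 :=
    e.adjoint_weightedShift_apply_of_notMem_range hA₂' (by simp)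
  have star_mul₁ (x y : ℕ) : ContinuousLinearMap.adjoint A₁ (A₁ (e (x, y))) =
      (1 - (q : ℂ) ^ (2 * x + 2)) • e (x, y) := by
    rw [hA₁, map_smul, adj₁, smul_smul, ofReal_sqrt_one_sub_pow_mul_self hq0 hq1]
  have star_mul₂ (x y : ℕ) : ContinuousLinearMap.adjoint A₂ (A₂ (e (x, y))) =
      (1 - (q : ℂ) ^ (2 * y + 2)) • e (x, y) := by
    rw [hA₂, map_smul, adj₂, smul_smul, ofReal_sqrt_one_sub_pow_mul_self hq0 hq1]
  have mul_star₁ (x y : ℕ) : A₁ (ContinuousLinearMap.adjoint A₁ (e (x, y))) =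
      (1 - (q : ℂ) ^ (2 * x)) • e (x, y) := by
    cases x with
    | zero => simp [adj₁_zero]
    | succ x =>
      rw [adj₁, map_smul, hA₁, smul_smul, ofReal_sqrt_one_sub_pow_mul_self hq0 hq1, mul_add_one]
  have mul_star₂ (x y : ℕ) : A₂ (ContinuousLinearMap.adjoint A₂ (e (x, y))) =
      (1 - (q : ℂ) ^ (2 * y)) • e (x, y) := by
    cases y with
    | zero => simp [adj₂_zero]
    | succ y =>
      rw [adj₂, map_smul, hA₂, smul_smul, ofReal_sqrt_one_sub_pow_mul_self hq0 hq1, mul_add_one]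
  refine e.continuousLinearMap_ext ?_
  rintro ⟨x, y⟩
  simp only [pow_two B₁, pow_two B₂, add_apply, sub_apply,
    smul_apply, mul_apply_eq_comp, map_smul, star_mul₁,
    star_mul₂, mul_star₁, mul_star₂, hB₁, hB₂]
  push_cast
  module
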